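/- Proposition 6: Let G be a representable Menger (2,n)-semigroup. Then χ₀ is an l-regular and v-negative quasi-order on G, and it is the least one: χ₀ ⊆ χ for every l-regular and v-negative quasi-order χ on G. -/

import Mathlib

universe u

/-- A partial `n`-place function on `A` (`none` = undefined). -/
abbrev NPlace (A : Type u) (n : ℕ) := (Fin n → A) → Option A

/-- The domain of a partial `n`-place function. -/
def pdom {A : Type u} {n : ℕ} (f : NPlace A n) : Set (Fin n → A) :=
  {a | (f a).isSome}

/-- Superposition `f[g₁…gₙ]` of partial `n`-place functions. -/
def superpose {A : Type u} {n : ℕ} (f : NPlace A n) (g : Fin n → NPlace A n) : NPlace A n :=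
  fun a => if h : ∀ i, (g i a).isSome then f (fun i => (g i a).get (h i)) else none

/-- The binary composition `f ∘ᵢ g` of partial `n`-place functions. -/
def opc {A : Type u} {n : ℕ} (i : Fin n) (f g : NPlace A n) : NPlace A n :=
  fun a => (g a).bind fun b => f (Function.update a i b)

/-- A Menger (2,n)-semigroup: an (n+1)-ary superassociative operation `sup`
(written `x[y₁…yₙ]`) together with `n` associative binary operations `op i`. -/
structure MengerSg (G : Type u) (n : ℕ) where
  sup : G → (Fin n → G) → G
  op : Fin n → G → G → G
  superassoc : ∀ (x : G) (y z : Fin n → G),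
    sup (sup x y) z = sup x fun i => sup (y i) z
  op_assoc : ∀ (i : Fin n) (x y z : G), op i (op i x y) z = op i x (op i y z)

namespace MengerSg

variable {G : Type u} {n : ℕ}

/-- Applying a composition string `L = [(i₁,y₁),…,(i_s,y_s)]` to `x`:
`x ∘_{i₁} y₁ ∘_{i₂} y₂ ⋯ ∘_{i_s} y_s` (left to right). -/
def applyStr (M : MengerSg G n) (x : G) (L : List (Fin n × G)) : G :=
  L.foldl (fun a p => M.op p.1 a p.2) x

/-- `μᵢ(L)`: if `i` occurs in the composition string `L` with least position `k`,
this is `some (yₖ ∘_{i_{k+1}} y_{k+1} ⋯ ∘_{i_s} y_s)`; otherwise `none`. -/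
def mu (M : MengerSg G n) (i : Fin n) : List (Fin n × G) → Option G
  | [] => none
  | p :: rest => if p.1 = i then some (applyStr M p.2 rest) else mu M i rest

/-- Conditions (4)–(7): the Menger (2,n)-semigroup is representable. -/
def Representable (M : MengerSg G n) : Prop :=
  (∀ L₁ L₂ : List (Fin n × G), L₁ ≠ [] → L₂ ≠ [] →
      (∀ i, mu M i L₁ = mu M i L₂) → ∀ g, applyStr M g L₁ = applyStr M g L₂) ∧
  (∀ (i : Fin n) (x y : G) (z : Fin n → G),
      M.sup (M.op i x y) z = M.sup x (Function.update z i (M.sup y z))) ∧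
  (∀ (i : Fin n) (x : G) (y : Fin n → G) (z : G),
      M.op i (M.sup x y) z = M.sup x fun j => M.op i (y j) z) ∧
  (∀ L : List (Fin n × G), L ≠ [] → ∀ m : Fin n → G,
      (∀ i, mu M i L = some (m i)) → ∀ x, applyStr M x L = M.sup x m)

/-- A binary relation is l-regular. -/
def LRegular (M : MengerSg G n) (r : G → G → Prop) : Prop :=
  ∀ x y, r x y →
    (∀ z : Fin n → G, r (M.sup x z) (M.sup y z)) ∧
    (∀ (i : Fin n) (z : G), r (M.op i x z) (M.op i y z))

/-- A binary relation is l-cancellative. -/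
def LCancellative (M : MengerSg G n) (r : G → G → Prop) : Prop :=
  (∀ (x y : G) (z : Fin n → G), r (M.sup x z) (M.sup y z) → r x y) ∧
  (∀ (x y : G) (i : Fin n) (z : G), r (M.op i x z) (M.op i y z) → r x y)

/-- A binary relation is v-negative. -/
def VNegative (M : MengerSg G n) (r : G → G → Prop) : Prop :=
  (∀ (x : G) (y : Fin n → G) (i : Fin n), r (M.sup x y) (y i)) ∧
  (∀ (x : G) (L : List (Fin n × G)), L ≠ [] →
      ∀ (j : Fin n) (m : G), mu M j L = some m → r (applyStr M x L) m)

/-- A quasi-order is a reflexive and transitive relation. -/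
def QuasiOrder (r : G → G → Prop) : Prop := Reflexive r ∧ Transitive r

/-- `z` is a zero of the Menger (2,n)-semigroup. -/
def IsZero (M : MengerSg G n) (z : G) : Prop :=
  (∀ (i : Fin n) (g : G), M.op i z g = z ∧ M.op i g z = z) ∧
  (∀ g : Fin n → G, M.sup z g = z) ∧
  (∀ (g : G) (gs : Fin n → G) (i : Fin n), M.sup g (Function.update gs i z) = z)

/-- A 0-quasi-equivalence: a symmetric relation which is reflexive at every non-zero
element, and such that any zero related to something is related to itself. -/
def ZeroQuasiEquiv (M : MengerSg G n) (r : G → G → Prop) : Prop :=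
  Symmetric r ∧ (∀ g, ¬ M.IsZero g → r g g) ∧
  (∀ z, M.IsZero z → (∃ h, r z h) → r z z)

/-- `P` is a representation of the Menger (2,n)-semigroup by `n`-place functions. -/
def IsRep (M : MengerSg G n) {A : Type u} (P : G → NPlace A n) : Prop :=
  (∀ (x : G) (y : Fin n → G), P (M.sup x y) = superpose (P x) fun i => P (y i)) ∧
  (∀ (i : Fin n) (x y : G), P (M.op i x y) = opc i (P x) (P y))

/-- The set `Tₙ(G)` of translations: the least set of maps `G → G` containing the
identity and closed under `t ↦ (x ↦ a[b₁…b_{i−1} t(x) b_{i+1}…bₙ])`. -/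
inductive IsTransl (M : MengerSg G n) : (G → G) → Prop
  | id : IsTransl M _root_.id
  | step (t : G → G) (ht : IsTransl M t) (i : Fin n) (a : G) (b : Fin n → G) :
      IsTransl M fun x => M.sup a (Function.update b i (t x))

/-- The relation `δ₁`: `g₁ = t(g₂)` for some `t ∈ Tₙ(G)`. -/
def delta1 (M : MengerSg G n) : G → G → Prop :=
  fun g₁ g₂ => ∃ t : G → G, IsTransl M t ∧ g₁ = t g₂

/-- The relation `δ₂`: `g₁ = (x∘_{i₁}y₁⋯∘_{i_s}y_s)` and `g₂ = μᵢ(L)`, possibly both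
superposed with a common `z̄ ∈ Gⁿ`. -/
def delta2 (M : MengerSg G n) : G → G → Prop :=
  fun g₁ g₂ => ∃ (x : G) (L : List (Fin n × G)) (i : Fin n) (m : G),
    L ≠ [] ∧ mu M i L = some m ∧
    ((g₁ = applyStr M x L ∧ g₂ = m) ∨
      ∃ z : Fin n → G, g₁ = M.sup (applyStr M x L) z ∧ g₂ = M.sup m z)

/-- `χ(π)`: the transitive closure of `(δ₂ ∪ Δ_G) ∘ δ₁ ∘ π` (relations applied right
to left in the paper's notation, i.e. first `π`, then `δ₁`, then `δ₂ ∪ Δ_G`). -/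
def chiRel (M : MengerSg G n) (π : G → G → Prop) : G → G → Prop :=
  Relation.TransGen
    (Relation.Comp (Relation.Comp π (delta1 M)) fun a b => delta2 M a b ∨ a = b)

/-- `χ₀`: the transitive closure of `(δ₂ ∪ Δ_G) ∘ δ₁`. -/
def chi0 (M : MengerSg G n) : G → G → Prop :=
  Relation.TransGen
    (Relation.Comp (delta1 M) fun a b => delta2 M a b ∨ a = b)

end MengerSg

namespace MengerSg

variable {G : Type u} {n : ℕ}

theorem applyStr_append_singleton (M : MengerSg G n) (x : G) (L : List (Fin n × G))
    (i : Fin n) (w : G) :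
    applyStr M x (L ++ [(i, w)]) = M.op i (applyStr M x L) w := by
  simp [applyStr]

theorem mu_append_singleton (M : MengerSg G n) {j : Fin n} {m : G} (i : Fin n) (w : G) :
    ∀ {L : List (Fin n × G)}, mu M j L = some m →
      mu M j (L ++ [(i, w)]) = some (M.op i m w)
  | [], h => by simp [mu] at h
  | p :: L, h => by
    by_cases hp : p.1 = j
    · simp only [mu, hp, if_true, Option.some.injEq] at h
      simp [mu, hp, applyStr_append_singleton, h]
    · simp only [mu, hp, if_false] at h
      simpa [mu, hp] using mu_append_singleton M i w h

theorem comp_update (f : G → G) (b : Fin n → G) (i : Fin n) (c : G) :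
    (fun j => f (Function.update b i c j)) = Function.update (fun j => f (b j)) i (f c) :=
  Function.comp_update f b i c

/-- A map acting on `sup` entrywise carries translations to translations. -/
theorem IsTransl.exists_semiconj {M : MengerSg G n} {t : G → G} (ht : IsTransl M t) {f : G → G}
    (hf : ∀ a b, f (M.sup a b) = M.sup a fun j => f (b j)) :
    ∃ s, IsTransl M s ∧ ∀ y, f (t y) = s (f y) := by
  induction ht with
  | id => exact ⟨_root_.id, .id, fun _ => rfl⟩
  | step t _ i a b ih =>
    obtain ⟨s, hs, h⟩ := ih
    refine ⟨_, .step s hs i a fun j => f (b j), fun y => ?_⟩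
    simp only [hf, comp_update, h]

theorem delta1.map {M : MengerSg G n} {f : G → G}
    (hf : ∀ a b, f (M.sup a b) = M.sup a fun j => f (b j)) {a b : G} (h : delta1 M a b) :
    delta1 M (f a) (f b) := by
  obtain ⟨t, ht, rfl⟩ := h
  obtain ⟨s, hs, h⟩ := ht.exists_semiconj hf
  exact ⟨s, hs, h b⟩

theorem delta2.sup {M : MengerSg G n} {a b : G} (h : delta2 M a b) (z : Fin n → G) :
    delta2 M (M.sup a z) (M.sup b z) := by
  obtain ⟨x, L, i, m, hL, hm, ⟨rfl, rfl⟩ | ⟨w, rfl, rfl⟩⟩ := h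
  · exact ⟨x, L, i, _, hL, hm, .inr ⟨z, rfl, rfl⟩⟩
  · exact ⟨x, L, i, m, hL, hm, .inr ⟨_, M.superassoc _ _ _, M.superassoc _ _ _⟩⟩

theorem delta2.op {M : MengerSg G n}
    (hM : ∀ (i : Fin n) (x : G) (y : Fin n → G) (z : G),
      M.op i (M.sup x y) z = M.sup x fun j => M.op i (y j) z)
    {a b : G} (h : delta2 M a b) (i : Fin n) (z : G) :
    delta2 M (M.op i a z) (M.op i b z) := by
  obtain ⟨x, L, j, m, hL, hm, ⟨rfl, rfl⟩ | ⟨w, rfl, rfl⟩⟩ := h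
  · exact ⟨x, L ++ [(i, z)], j, _, by simp, mu_append_singleton M i z hm,
      .inl ⟨(applyStr_append_singleton M x L i z).symm, rfl⟩⟩
  · exact ⟨x, L, j, m, hL, hm, .inr ⟨_, hM _ _ _ _, hM _ _ _ _⟩⟩

theorem delta1.chi0 {M : MengerSg G n} {a b : G} (h : delta1 M a b) : chi0 M a b :=
  .single ⟨b, h, .inr rfl⟩

theorem delta2.chi0 {M : MengerSg G n} {a b : G} (h : delta2 M a b) : chi0 M a b :=
  .single ⟨a, ⟨_root_.id, .id, rfl⟩, .inl h⟩

theorem quasiOrder_chi0 (M : MengerSg G n) : QuasiOrder (chi0 M) :=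
  ⟨fun _ => delta1.chi0 ⟨_root_.id, .id, rfl⟩, fun _ _ _ => Relation.TransGen.trans⟩

theorem chi0.map {M : MengerSg G n} {f : G → G}
    (hf : ∀ a b, f (M.sup a b) = M.sup a fun j => f (b j))
    (hf₂ : ∀ a b, delta2 M a b → delta2 M (f a) (f b)) {a b : G} (h : chi0 M a b) :
    chi0 M (f a) (f b) :=
  Relation.TransGen.lift f
    (fun _ _ ⟨c, h₁, h₂⟩ => ⟨f c, h₁.map hf, h₂.imp (hf₂ _ _) (congrArg f)⟩) _ _ h

theorem lRegular_chi0 {M : MengerSg G n} (hM : M.Representable) : M.LRegular (chi0 M) :=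
  fun _ _ h =>
    ⟨fun z => h.map (f := fun x => M.sup x z) (fun a b => M.superassoc a b z)
        fun _ _ h => h.sup z,
      fun i z => h.map (f := fun x => M.op i x z) (fun a b => hM.2.2.1 i a b z)
        fun _ _ h => h.op hM.2.2.1 i z⟩

theorem vNegative_chi0 (M : MengerSg G n) : M.VNegative (chi0 M) :=
  ⟨fun x y i => delta1.chi0 ⟨_, .step _root_.id .id i x y, by simp⟩,
    fun x L hL j m hm => delta2.chi0 ⟨x, L, j, m, hL, hm, .inl ⟨rfl, rfl⟩⟩⟩

theorem delta1_le {M : MengerSg G n} {χ : G → G → Prop} (hq : QuasiOrder χ)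
    (hv : M.VNegative χ) {a b : G} (h : delta1 M a b) : χ a b := by
  obtain ⟨t, ht, rfl⟩ := h
  induction ht with
  | id => exact hq.1 b
  | step t _ i a c ih =>
    have h := hv.1 a (Function.update c i (t b)) i
    rw [Function.update_self] at h
    exact hq.2 h ih

theorem delta2_le {M : MengerSg G n} {χ : G → G → Prop} (hl : M.LRegular χ)
    (hv : M.VNegative χ) {a b : G} (h : delta2 M a b) : χ a b := by
  obtain ⟨x, L, i, m, hL, hm, ⟨rfl, rfl⟩ | ⟨w, rfl, rfl⟩⟩ := h
  · exact hv.2 x L hL i _ hm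
  · exact (hl _ _ (hv.2 x L hL i m hm)).1 w

theorem chi0_le {M : MengerSg G n} {χ : G → G → Prop} (hq : QuasiOrder χ) (hl : M.LRegular χ)
    (hv : M.VNegative χ) {a b : G} (h : chi0 M a b) : χ a b := by
  have step : ∀ {a b}, Relation.Comp (delta1 M) (fun a b => delta2 M a b ∨ a = b) a b → χ a b := by
    rintro a b ⟨c, h₁, h₂ | rfl⟩
    · exact hq.2 (delta1_le hq hv h₁) (delta2_le hl hv h₂)
    · exact delta1_le hq hv h₁
  induction h with
  | single h => exact step h
  | tail _ h ih => exact hq.2 ih (step h)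

end MengerSg

open MengerSg

/-- Proposition 6: χ₀ is the least l-regular and v-negative quasi-order. -/
theorem prop6 {G : Type u} {n : ℕ} (hn : 1 ≤ n)
    (M : MengerSg G n) (hM : M.Representable) :
    (QuasiOrder (chi0 M) ∧ M.LRegular (chi0 M) ∧ M.VNegative (chi0 M)) ∧
      ∀ χ : G → G → Prop, QuasiOrder χ → M.LRegular χ → M.VNegative χ →
        ∀ a b, chi0 M a b → χ a b := by
  exact ⟨⟨quasiOrder_chi0 M, lRegular_chi0 hM, vNegative_chi0 M⟩,
    fun _ hq hl hv _ _ h => chi0_le hq hl hv h⟩
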